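/- Let I and I′ be combinatorial chambers and W a wall that is an essential wall of both F(I) and F(I′), such that the interiors of F(I) and F(I′) lie on opposite open sides of W and F(I) ∩ F(I′) ∩ W has affine dimension r−1 (the two chambers are W-adjacent). Then I′ = reflexion(I,W), where reflexion(I,W) = I(W|cut) ∪ ⋃_{ν ∈ B(W,I)} δ⁻(ν) and B(W,I) = {σ ∩ zeros(W) : σ ∈ I(W|facet)}. -/

import Mathlib

noncomputable section

/-- The closed convex cone of nonnegative linear combinations of `{φ i : i ∈ σ}`. -/
def coneOf {N r : ℕ} (φ : Fin N → (Fin r → ℝ)) (σ : Finset (Fin N)) : Set (Fin r → ℝ) :=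
  {y | ∃ c : Fin N → ℝ, (∀ i, 0 ≤ c i) ∧ (∀ i, i ∉ σ → c i = 0) ∧ y = ∑ i, c i • φ i}

/-- `σ` is a basic subset: `r` indices whose vectors are linearly independent. -/
def IsBasic {N r : ℕ} (φ : Fin N → (Fin r → ℝ)) (σ : Finset (Fin N)) : Prop :=
  σ.card = r ∧ LinearIndependent ℝ (fun i : {i // i ∈ σ} => φ i)

/-- `F(I) = ⋂_{σ ∈ I} C(σ)`. -/
def Fcone {N r : ℕ} (φ : Fin N → (Fin r → ℝ)) (I : Set (Finset (Fin N))) :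
    Set (Fin r → ℝ) :=
  ⋂ σ ∈ I, coneOf φ σ

/-- `I` is feasible when `F(I)` has nonempty interior. -/
def IsFeasible {N r : ℕ} (φ : Fin N → (Fin r → ℝ)) (I : Set (Finset (Fin N))) : Prop :=
  (interior (Fcone φ I)).Nonempty

/-- A combinatorial chamber: a maximal feasible set of basic subsets. -/
def IsChamber {N r : ℕ} (φ : Fin N → (Fin r → ℝ)) (I : Set (Finset (Fin N))) : Prop :=
  (∀ σ ∈ I, IsBasic φ σ) ∧ IsFeasible φ I ∧
  ∀ J : Set (Finset (Fin N)), I ⊆ J → (∀ σ ∈ J, IsBasic φ σ) → IsFeasible φ J → J = I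

/-- A wall: an `(r-1)`-dimensional subspace spanned by `r - 1` linearly independent
vectors from `Δ⁺`. -/
def IsWall {N r : ℕ} (φ : Fin N → (Fin r → ℝ)) (W : Submodule ℝ (Fin r → ℝ)) : Prop :=
  ∃ s : Finset (Fin N), s.card = r - 1 ∧
    LinearIndependent ℝ (fun i : {i // i ∈ s} => φ i) ∧
    W = Submodule.span ℝ (φ '' (s : Set (Fin N)))

/-- `σ ∈ I(W|facet)` relative to a defining functional `f` for the wall `W`:
`|σ ∩ zeros(W)| = r - 1`. -/
def FacetOf {N r : ℕ} (φ : Fin N → (Fin r → ℝ)) (f : (Fin r → ℝ) →ₗ[ℝ] ℝ)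
    (σ : Finset (Fin N)) : Prop :=
  ((σ : Set (Fin N)) ∩ {i | f (φ i) = 0}).ncard = r - 1

/-- `σ ∈ I(W|cut)` relative to a defining functional `f` for the wall `W`:
`σ` meets both open sides of `W`. -/
def CutOf {N r : ℕ} (φ : Fin N → (Fin r → ℝ)) (f : (Fin r → ℝ) →ₗ[ℝ] ℝ)
    (σ : Finset (Fin N)) : Prop :=
  (∃ i ∈ σ, 0 < f (φ i)) ∧ (∃ i ∈ σ, f (φ i) < 0)

attribute [local instance] Classical.propDecidable

section Coordinates

variable {N r : ℕ} {φ : Fin N → (Fin r → ℝ)} {σ τ : Finset (Fin N)}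

/-- The basis of `ℝ^r` attached to a basic subset. -/
def IsBasic.basis (h : IsBasic φ σ) : Module.Basis {i // i ∈ σ} ℝ (Fin r → ℝ) :=
  basisOfLinearIndependentOfCardEqFinrank' _ h.2 (by simp [h.1])

/-- The `i`-th coordinate functional with respect to a basic subset `σ`; zero if `i ∉ σ`. -/
def IsBasic.coef (h : IsBasic φ σ) (i : Fin N) : (Fin r → ℝ) →ₗ[ℝ] ℝ :=
  if hi : i ∈ σ then h.basis.coord ⟨i, hi⟩ else 0

lemma IsBasic.basis_apply (h : IsBasic φ σ) (i : {i // i ∈ σ}) : h.basis i = φ i := by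
  simp [IsBasic.basis]

lemma IsBasic.sum_coef (h : IsBasic φ σ) (y : Fin r → ℝ) :
    ∑ k ∈ σ, h.coef k y • φ k = y := by
  rw [← Finset.sum_attach]
  conv_rhs => rw [← h.basis.sum_repr y]
  simp [IsBasic.coef, IsBasic.basis_apply]

lemma IsBasic.coef_self (h : IsBasic φ σ) {i k : Fin N} (hi : i ∈ σ) (hk : k ∈ σ) :
    h.coef i (φ k) = if k = i then 1 else 0 := by
  have : φ k = h.basis ⟨k, hk⟩ := (h.basis_apply ⟨k, hk⟩).symm
  rw [this]
  simp [IsBasic.coef, hi, Finsupp.single_apply]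

lemma IsBasic.coef_sum (h : IsBasic φ σ) {i : Fin N} (hi : i ∈ σ) (d : Fin N → ℝ) :
    h.coef i (∑ k ∈ σ, d k • φ k) = d i := by
  rw [map_sum, Finset.sum_eq_single i]
  · simp [h.coef_self hi hi]
  · intro k hk hki
    simp [h.coef_self hi hk, hki]
  · exact fun h' => absurd hi h'

lemma IsBasic.map_eq_sum (h : IsBasic φ σ) (f : (Fin r → ℝ) →ₗ[ℝ] ℝ) (y : Fin r → ℝ) :
    f y = ∑ k ∈ σ, h.coef k y * f (φ k) := by
  conv_lhs => rw [← h.sum_coef y]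
  simp

lemma IsBasic.mem_coneOf_iff (h : IsBasic φ σ) {y : Fin r → ℝ} :
    y ∈ coneOf φ σ ↔ ∀ i ∈ σ, 0 ≤ h.coef i y := by
  constructor
  · rintro ⟨c, hc, hc0, rfl⟩ i hi
    have : ∑ k, c k • φ k = ∑ k ∈ σ, c k • φ k := by
      symm
      apply Finset.sum_subset (Finset.subset_univ _)
      intro k _ hk
      simp [hc0 k hk]
    rw [this, h.coef_sum hi]
    exact hc i
  · intro hy
    refine ⟨fun i => h.coef i y, fun i => ?_, fun i hi => ?_, ?_⟩
    · by_cases hi : i ∈ σ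
      · exact hy i hi
      · simp [IsBasic.coef, hi]
    · simp [IsBasic.coef, hi]
    · conv_lhs => rw [← h.sum_coef y]
      apply Finset.sum_subset (Finset.subset_univ _)
      intro k _ hk
      simp [IsBasic.coef, hk]

lemma IsBasic.mem_interior_coneOf (h : IsBasic φ σ) {y : Fin r → ℝ}
    (hy : ∀ i ∈ σ, 0 < h.coef i y) : y ∈ interior (coneOf φ σ) := by
  rw [mem_interior]
  refine ⟨⋂ i ∈ σ, {z | 0 < h.coef i z}, fun z hz => ?_, ?_, by simpa using hy⟩
  · simp only [Set.mem_iInter, Set.mem_ofPred_eq] at hz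
    exact h.mem_coneOf_iff.2 fun i hi => (hz i hi).le
  · exact isOpen_biInter_finset fun i _ =>
      isOpen_lt continuous_const (h.coef i).continuous_of_finiteDimensional

lemma add_mem_Fcone {I : Set (Finset (Fin N))} {x y : Fin r → ℝ}
    (hx : x ∈ Fcone φ I) (hy : y ∈ Fcone φ I) : x + y ∈ Fcone φ I := by
  simp only [Fcone, Set.mem_iInter] at *
  intro σ hσ
  obtain ⟨c, hc, hc0, rfl⟩ := hx σ hσ
  obtain ⟨d, hd, hd0, rfl⟩ := hy σ hσ
  refine ⟨c + d, fun i => add_nonneg (hc i) (hd i), fun i hi => ?_, ?_⟩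
  · simp [hc0 i hi, hd0 i hi]
  · simp [add_smul, Finset.sum_add_distrib]

lemma smul_mem_Fcone {I : Set (Finset (Fin N))} {x : Fin r → ℝ} {t : ℝ} (ht : 0 ≤ t)
    (hx : x ∈ Fcone φ I) : t • x ∈ Fcone φ I := by
  simp only [Fcone, Set.mem_iInter] at *
  intro σ hσ
  obtain ⟨c, hc, hc0, rfl⟩ := hx σ hσ
  refine ⟨t • c, fun i => mul_nonneg ht (hc i), fun i hi => ?_, ?_⟩
  · simp [hc0 i hi]
  · simp [Finset.smul_sum, smul_smul]

lemma zero_mem_Fcone {I : Set (Finset (Fin N))} : (0 : Fin r → ℝ) ∈ Fcone φ I := by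
  simp only [Fcone, Set.mem_iInter]
  exact fun σ _ => ⟨0, by simp, by simp, by simp⟩

lemma add_mem_interior_Fcone {I : Set (Finset (Fin N))} {x y : Fin r → ℝ}
    (hx : x ∈ Fcone φ I) (hy : y ∈ interior (Fcone φ I)) :
    x + y ∈ interior (Fcone φ I) := by
  rw [mem_interior]
  refine ⟨(Homeomorph.addLeft x) '' interior (Fcone φ I), ?_,
    (Homeomorph.addLeft x).isOpenMap _ isOpen_interior, ⟨y, hy, rfl⟩⟩
  rintro _ ⟨z, hz, rfl⟩
  exact add_mem_Fcone hx (interior_subset hz)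

lemma IsChamber.mem_of_mem_interior {I : Set (Finset (Fin N))} (hI : IsChamber φ I)
    (h : IsBasic φ τ) {z : Fin r → ℝ} (hz : z ∈ interior (Fcone φ I))
    (hzτ : z ∈ interior (coneOf φ τ)) : τ ∈ I := by
  have key := hI.2.2 (insert τ I) (Set.subset_insert _ _) ?_ ?_
  · rw [← key]
    exact Set.mem_insert _ _
  · rintro σ (rfl | hσ)
    exacts [h, hI.1 σ hσ]
  · refine ⟨z, ?_⟩
    rw [Fcone, Set.biInter_insert, interior_inter]
    exact ⟨hzτ, hz⟩

/-- A basic subset belongs to a chamber as soon as its cone contains all points close to `x`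
in the direction of an interior point `y`. -/
lemma IsChamber.mem_of_coef {I : Set (Finset (Fin N))} (hI : IsChamber φ I)
    (h : IsBasic φ τ) {x y : Fin r → ℝ} (hx : x ∈ Fcone φ I)
    (hy : y ∈ interior (Fcone φ I))
    (hpos : ∀ k ∈ τ, 0 < h.coef k x ∨ (h.coef k x = 0 ∧ 0 < h.coef k y)) : τ ∈ I := by
  have hev : ∀ᶠ t : ℝ in Filter.atTop, ∀ k ∈ τ, 0 < t * h.coef k x + h.coef k y := by
    rw [Filter.eventually_all_finset]
    intro k hk
    rcases hpos k hk with hk | ⟨hk, hk'⟩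
    · exact (Filter.tendsto_atTop_add_const_right _ _
        (Filter.tendsto_id.atTop_mul_const hk)).eventually_gt_atTop 0
    · simp [hk, hk']
  obtain ⟨t, ht, ht0⟩ := (hev.and (Filter.eventually_ge_atTop 0)).exists
  refine hI.mem_of_mem_interior h (add_mem_interior_Fcone (smul_mem_Fcone ht0 hx) hy)
    (h.mem_interior_coneOf fun k hk => ?_)
  simpa using ht k hk

lemma coef_nonneg_of_mem_Fcone {I : Set (Finset (Fin N))} {x : Fin r → ℝ}
    (hx : x ∈ Fcone φ I) (hσ : σ ∈ I) (h : IsBasic φ σ) {i : Fin N} (hi : i ∈ σ) :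
    0 ≤ h.coef i x :=
  h.mem_coneOf_iff.1 (Set.mem_iInter₂.1 hx σ hσ) i hi

/-- `x` lies on no face of a cone `C(σ)`, `σ ∈ I`, other than facets inside `ker f`. -/
def IsGenericOn (φ : Fin N → (Fin r → ℝ)) (f : (Fin r → ℝ) →ₗ[ℝ] ℝ)
    (I : Set (Finset (Fin N))) (x : Fin r → ℝ) : Prop :=
  ∀ σ ∈ I, ∀ h : IsBasic φ σ, ∀ i ∈ σ, h.coef i x = 0 → ∀ k ∈ σ, k ≠ i → f (φ k) = 0

lemma IsGenericOn.neg {f : (Fin r → ℝ) →ₗ[ℝ] ℝ} {I : Set (Finset (Fin N))} {x : Fin r → ℝ}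
    (hx : IsGenericOn φ f I x) : IsGenericOn φ (-f) I x :=
  fun σ hσ h i hi h0 k hk hki => by simp [hx σ hσ h i hi h0 k hk hki]

lemma IsBasic.exchange (h : IsBasic φ σ) {f : (Fin r → ℝ) →ₗ[ℝ] ℝ} {i j : Fin N}
    (hj : j ∈ σ) (hz : ∀ k ∈ σ, k ≠ j → f (φ k) = 0) (hi : f (φ i) ≠ 0) :
    IsBasic φ (insert i (σ.erase j)) := by
  have hni : i ∉ σ.erase j := fun hmem =>
    hi (hz i (Finset.mem_of_mem_erase hmem) (Finset.ne_of_mem_erase hmem))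
  refine ⟨?_, ?_⟩
  · rw [Finset.card_insert_of_notMem hni, Finset.card_erase_add_one hj, h.1]
  · have hlin : LinearIndepOn ℝ φ (σ : Set (Fin N)) := h.2
    have : LinearIndepOn ℝ φ (insert i ((σ.erase j : Finset (Fin N)) : Set (Fin N))) := by
      refine (hlin.mono (Finset.coe_subset.2 (Finset.erase_subset _ _))).insert fun hmem => hi ?_
      have hle : Submodule.span ℝ (φ '' ((σ.erase j : Finset (Fin N)) : Set (Fin N))) ≤
          LinearMap.ker f := by
        rw [Submodule.span_le]
        rintro _ ⟨k, hk, rfl⟩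
        have hk' := Finset.mem_coe.1 hk
        exact hz k (Finset.mem_of_mem_erase hk') (Finset.ne_of_mem_erase hk')
      exact hle hmem
    rw [← Finset.coe_insert] at this
    exact this

variable {I I' : Set (Finset (Fin N))} {f : (Fin r → ℝ) →ₗ[ℝ] ℝ} {x y' : Fin r → ℝ}

lemma IsChamber.mem_of_cut (hI : IsChamber φ I) (hI' : IsChamber φ I')
    (hx : x ∈ Fcone φ I) (hx' : x ∈ Fcone φ I') (hgen : IsGenericOn φ f I x)
    (hy' : y' ∈ interior (Fcone φ I')) (hσ : σ ∈ I) (hcut : CutOf φ f σ) : σ ∈ I' := by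
  have h := hI.1 σ hσ
  refine hI'.mem_of_coef h hx' hy' fun k hk => Or.inl ?_
  refine lt_of_le_of_ne (coef_nonneg_of_mem_Fcone hx hσ h hk) fun h0 => ?_
  have hz := hgen σ hσ h k hk h0.symm
  obtain ⟨⟨a, ha, hfa⟩, ⟨b, hb, hfb⟩⟩ := hcut
  by_cases hak : a = k
  · by_cases hbk : b = k
    · subst hak hbk
      exact lt_asymm hfa hfb
    · exact hfb.ne (hz b hb hbk)
  · exact hfa.ne' (hz a ha hak)

lemma IsChamber.insert_erase_mem (hI : IsChamber φ I) (hI' : IsChamber φ I')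
    (hx : x ∈ Fcone φ I) (hx' : x ∈ Fcone φ I') (hgen : IsGenericOn φ f I x) (hfx : f x = 0)
    (hy' : y' ∈ interior (Fcone φ I')) (hfy' : f y' < 0) (hσ : σ ∈ I) {i j : Fin N}
    (hj : j ∈ σ) (hz : ∀ k ∈ σ, k ≠ j → f (φ k) = 0) (hfj : f (φ j) ≠ 0)
    (hfi : f (φ i) < 0) : insert i (σ.erase j) ∈ I' := by
  have h := hI.1 σ hσ
  have hτ := h.exchange hj hz hfi.ne
  have hni : i ∉ σ.erase j := fun hmem =>
    hfi.ne (hz i (Finset.mem_of_mem_erase hmem) (Finset.ne_of_mem_erase hmem))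
  have hcj : h.coef j x = 0 := by
    have := h.map_eq_sum f x
    rw [hfx, Finset.sum_eq_single_of_mem j hj fun k hk hkj => by simp [hz k hk hkj]] at this
    exact (mul_eq_zero.1 this.symm).resolve_right hfj
  have hxsum : x = ∑ k ∈ insert i (σ.erase j),
      (if k = i then 0 else h.coef k x) • φ k := by
    rw [Finset.sum_insert hni]
    conv_lhs => rw [← h.sum_coef x, ← Finset.add_sum_erase _ _ hj, hcj]
    simp only [zero_smul, zero_add, if_true]
    refine Finset.sum_congr rfl fun k hk => ?_
    have hki : k ≠ i := fun hki => hni (hki ▸ hk)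
    rw [if_neg hki]
  have hcoef : ∀ k ∈ insert i (σ.erase j),
      hτ.coef k x = if k = i then 0 else h.coef k x := fun k hk => by
    conv_lhs => rw [hxsum]
    exact hτ.coef_sum hk _
  refine hI'.mem_of_coef hτ hx' hy' fun k hk => ?_
  rw [hcoef k hk]
  by_cases hki : k = i
  · subst hki
    refine Or.inr ⟨if_pos rfl, ?_⟩
    have := hτ.map_eq_sum f y'
    rw [Finset.sum_eq_single_of_mem k hk fun l hl hlk => by
      have hl' := Finset.mem_of_mem_insert_of_ne hl hlk
      simp [hz l (Finset.mem_of_mem_erase hl') (Finset.ne_of_mem_erase hl')]] at this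
    rw [this] at hfy'
    by_contra hle
    exact hfy'.not_ge (mul_nonneg_of_nonpos_of_nonpos (not_lt.1 hle) hfi.le)
  · have hk' := Finset.mem_of_mem_insert_of_ne hk hki
    have hkσ := Finset.mem_of_mem_erase hk'
    rw [if_neg hki]
    refine Or.inl (lt_of_le_of_ne (coef_nonneg_of_mem_Fcone hx hσ h hkσ) fun h0 => hfj ?_)
    exact hgen σ hσ h k hkσ h0.symm j hj (Finset.ne_of_mem_erase hk').symm

/-- A point of a cone `S` at which every functional of a finite family, nonnegative on `S`,
vanishes only if it vanishes on all of `S`. -/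
lemma exists_mem_forall_eq_zero_imp {ι E : Type*} [AddCommGroup E] [Module ℝ E] {S : Set E}
    (h0 : (0 : E) ∈ S) (hadd : ∀ x ∈ S, ∀ y ∈ S, x + y ∈ S) (s : Finset ι)
    (g : ι → E →ₗ[ℝ] ℝ) (hg : ∀ i ∈ s, ∀ x ∈ S, 0 ≤ g i x) :
    ∃ x ∈ S, ∀ i ∈ s, g i x = 0 → ∀ z ∈ S, g i z = 0 := by
  have hw : ∀ i, ∃ w ∈ S, g i w = 0 → ∀ z ∈ S, g i z = 0 := fun i => by
    by_cases h : ∀ z ∈ S, g i z = 0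
    · exact ⟨0, h0, fun _ => h⟩
    · push Not at h
      obtain ⟨w, hw, hne⟩ := h
      exact ⟨w, hw, fun h => absurd h hne⟩
  choose w hwS hw using hw
  refine ⟨∑ i ∈ s, w i, Finset.sum_induction _ (· ∈ S) (fun a b ha hb => hadd a ha b hb) h0
    fun i _ => hwS i, fun i hi h => hw i ?_⟩
  rw [map_sum, Finset.sum_eq_zero_iff_of_nonneg fun j _ => hg i hi _ (hwS j)] at h
  exact h i hi

lemma exists_isGenericOn (hI : IsChamber φ I) (hI' : IsChamber φ I') (hf : f ≠ 0)
    (hadj : Module.finrank ℝ (vectorSpan ℝ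
      (Fcone φ I ∩ Fcone φ I' ∩ (LinearMap.ker f : Set (Fin r → ℝ)))) = r - 1) :
    ∃ x ∈ Fcone φ I ∩ Fcone φ I' ∩ (LinearMap.ker f : Set (Fin r → ℝ)),
      IsGenericOn φ f (I ∪ I') x := by
  set S := Fcone φ I ∩ Fcone φ I' ∩ (LinearMap.ker f : Set (Fin r → ℝ)) with hS
  have hbasic : ∀ σ ∈ I ∪ I', IsBasic φ σ := fun σ hσ => hσ.elim (hI.1 σ) (hI'.1 σ)
  have h0 : (0 : Fin r → ℝ) ∈ S := ⟨⟨zero_mem_Fcone, zero_mem_Fcone⟩, Submodule.zero_mem _⟩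
  obtain ⟨x, hx, hgen⟩ := exists_mem_forall_eq_zero_imp h0
    (fun x hx y hy => ⟨⟨add_mem_Fcone hx.1.1 hy.1.1, add_mem_Fcone hx.1.2 hy.1.2⟩,
      Submodule.add_mem _ hx.2 hy.2⟩)
    (Finset.univ : Finset ({σ // σ ∈ I ∪ I'} × Fin N))
    (fun p => (hbasic p.1 p.1.2).coef p.2) (by
      rintro ⟨⟨σ, hσ⟩, i⟩ - x hx
      by_cases hi : i ∈ σ
      · rcases hσ with hσ | hσ
        · exact coef_nonneg_of_mem_Fcone hx.1.1 hσ _ hi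
        · exact coef_nonneg_of_mem_Fcone hx.1.2 hσ _ hi
      · simp [IsBasic.coef, hi])
  refine ⟨x, hx, fun σ hσ h i hi hix k hk hki => ?_⟩
  have hzero : ∀ z ∈ S, h.coef i z = 0 := hgen (⟨σ, hσ⟩, i) (Finset.mem_univ _) hix
  have hle : ∀ g : (Fin r → ℝ) →ₗ[ℝ] ℝ, (∀ z ∈ S, g z = 0) →
      vectorSpan ℝ S ≤ LinearMap.ker g := fun g hg => by
    rw [vectorSpan_def, Submodule.span_le]
    rintro _ ⟨a, ha, b, hb, rfl⟩
    simp [hg a ha, hg b hb]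
  have heq : vectorSpan ℝ S = LinearMap.ker f := by
    refine Submodule.eq_of_le_of_finrank_eq (hle f fun z hz => hz.2) ?_
    have := Module.Dual.finrank_ker_add_one_of_ne_zero (f := f) hf
    rw [Module.finrank_fin_fun] at this
    omega
  have hker : LinearMap.ker f ≤ LinearMap.ker (h.coef i) := heq ▸ hle _ hzero
  have hfi : f (φ i) ≠ 0 := fun hfi => by
    have : h.coef i (φ i) = 0 := hker hfi
    simp [h.coef_self hi hi] at this
  have hmem : f (φ k) • φ i - f (φ i) • φ k ∈ LinearMap.ker f := by
    simp [mul_comm]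
  have : h.coef i (f (φ k) • φ i - f (φ i) • φ k) = 0 := hker hmem
  simpa [h.coef_self hi hi, h.coef_self hi hk, hki] using this

lemma exists_pos_of_mem_Fcone {y : Fin r → ℝ} (hy : y ∈ Fcone φ I) (hfy : 0 < f y)
    (hσ : σ ∈ I) : ∃ j ∈ σ, 0 < f (φ j) := by
  obtain ⟨c, hc, hc0, rfl⟩ := Set.mem_iInter₂.1 hy σ hσ
  rw [map_sum] at hfy
  obtain ⟨j, -, hj⟩ := Finset.exists_lt_of_sum_lt (f := fun _ => (0 : ℝ)) (by simpa using hfy)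
  replace hj : 0 < c j * f (φ j) := by simpa using hj
  refine ⟨j, ?_, pos_of_mul_pos_right hj (hc j)⟩
  by_contra hjσ
  simp [hc0 j hjσ] at hj

/-- The part of an element of `I` inside `ker f` omits exactly one index. -/
lemma IsBasic.exists_filter_eq_erase (h : IsBasic φ σ) (hfacet : FacetOf φ f σ)
    (hne : ∃ j ∈ σ, f (φ j) ≠ 0) :
    ∃ j ∈ σ, f (φ j) ≠ 0 ∧ (∀ k ∈ σ, k ≠ j → f (φ k) = 0) ∧
      σ.filter (fun k => f (φ k) = 0) = σ.erase j := by
  obtain ⟨j, hj, hfj⟩ := hne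
  have hcard : (σ.filter fun k => f (φ k) = 0).card = r - 1 := by
    rw [← Set.ncard_coe_finset, Finset.coe_filter]
    exact hfacet
  have heq : σ.filter (fun k => f (φ k) = 0) = σ.erase j := by
    refine Finset.eq_of_subset_of_card_le (fun k hk => ?_) ?_
    · rw [Finset.mem_filter] at hk
      exact Finset.mem_erase.2 ⟨fun hkj => hfj (hkj ▸ hk.2), hk.1⟩
    · rw [hcard, Finset.card_erase_of_mem hj, h.1]
  refine ⟨j, hj, hfj, fun k hk hkj => ?_, heq⟩
  have : k ∈ σ.filter fun k => f (φ k) = 0 := heq ▸ Finset.mem_erase.2 ⟨hkj, hk⟩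
  exact (Finset.mem_filter.1 this).2

end Coordinates

/-- if two chambers are `W`-adjacent across an essential wall `W`, the
second is obtained from the first by the reflexion operation
`reflexion(I,W) = I(W|cut) ∪ ⋃_{ν ∈ B(W,I)} δ⁻(ν)`. -/
theorem adjacent_chamber_eq_reflexion
    {N r : ℕ} (φ : Fin N → (Fin r → ℝ)) (hφ : ∀ i, φ i ≠ 0)
    (hspan : Submodule.span ℝ (Set.range φ) = ⊤)
    (I I' : Set (Finset (Fin N))) (hI : IsChamber φ I) (hI' : IsChamber φ I')
    (W : Submodule ℝ (Fin r → ℝ)) (hW : IsWall φ W)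
    (f : (Fin r → ℝ) →ₗ[ℝ] ℝ) (hker : LinearMap.ker f = W)
    (hsideI : ∀ x ∈ Fcone φ I, 0 ≤ f x)
    (hsideI' : ∀ x ∈ Fcone φ I', f x ≤ 0)
    (hopenI : ∀ x ∈ interior (Fcone φ I), 0 < f x)
    (hopenI' : ∀ x ∈ interior (Fcone φ I'), f x < 0)
    (hdimI : Module.finrank ℝ
      (vectorSpan ℝ (Fcone φ I ∩ (W : Set (Fin r → ℝ)))) = r - 1)
    (hdimI' : Module.finrank ℝ
      (vectorSpan ℝ (Fcone φ I' ∩ (W : Set (Fin r → ℝ)))) = r - 1)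
    (hadj : Module.finrank ℝ
      (vectorSpan ℝ (Fcone φ I ∩ Fcone φ I' ∩ (W : Set (Fin r → ℝ)))) = r - 1) :
    I' = {σ | σ ∈ I ∧ CutOf φ f σ} ∪
      {τ | ∃ σ ∈ I, FacetOf φ f σ ∧
        ∃ i, f (φ i) < 0 ∧ τ = insert i (σ.filter (fun j => f (φ j) = 0))} := by
  subst hker
  obtain ⟨y, hy⟩ := hI.2.1
  obtain ⟨y', hy'⟩ := hI'.2.1
  have hfy := hopenI y hy
  have hfy' := hopenI' y' hy'
  have hf : f ≠ 0 := by
    rintro rfl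
    simp at hfy
  obtain ⟨x, ⟨⟨hx, hx'⟩, hfx⟩, hgen⟩ := exists_isGenericOn hI hI' hf hadj
  have hgenI : IsGenericOn φ f I x := fun σ hσ => hgen σ (Or.inl hσ)
  have hgenI' : IsGenericOn φ f I' x := fun σ hσ => hgen σ (Or.inr hσ)
  replace hfx : f x = 0 := hfx
  ext τ
  constructor
  · intro hτ
    by_cases hcut : CutOf φ f τ
    · exact Or.inl ⟨hI'.mem_of_cut hI hx' hx hgenI' hy hτ hcut, hcut⟩
    · right
      have h := hI'.1 τ hτ
      obtain ⟨i, hi, hfi⟩ := exists_pos_of_mem_Fcone (f := -f) (interior_subset hy')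
        (by simpa using hfy') hτ
      replace hfi : f (φ i) < 0 := by simpa using hfi
      have hnonpos : ∀ k ∈ τ, f (φ k) ≤ 0 := fun k hk =>
        not_lt.1 fun hfk => hcut ⟨⟨k, hk, hfk⟩, ⟨i, hi, hfi⟩⟩
      have hcoef : h.coef i x = 0 := by
        have hsum := h.map_eq_sum f x
        rw [hfx, eq_comm, Finset.sum_eq_zero_iff_of_nonpos fun k hk =>
          mul_nonpos_of_nonneg_of_nonpos (coef_nonneg_of_mem_Fcone hx' hτ h hk)
            (hnonpos k hk)] at hsum
        exact (mul_eq_zero.1 (hsum i hi)).resolve_right hfi.ne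
      have hz := hgenI' τ hτ h i hi hcoef
      have hne : I.Nonempty := by
        by_contra hemp
        rw [Set.not_nonempty_iff_eq_empty] at hemp
        have := hsideI y' (by simp [hemp, Fcone])
        linarith
      obtain ⟨σ₀, hσ₀⟩ := hne
      obtain ⟨j, -, hfj⟩ := exists_pos_of_mem_Fcone (interior_subset hy) hfy hσ₀
      have hσ : insert j (τ.erase i) ∈ I :=
        hI'.insert_erase_mem (f := -f) hI hx' hx hgenI'.neg (by simp [hfx]) hy
          (by simpa using hfy) hτ hi (fun k hk hki => by simp [hz k hk hki])
          (by simpa using hfi.ne) (by simpa using hfj)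
      have hfilter : (insert j (τ.erase i)).filter (fun k => f (φ k) = 0) = τ.erase i := by
        rw [Finset.filter_insert, if_neg hfj.ne', Finset.filter_eq_self]
        exact fun k hk => hz k (Finset.mem_of_mem_erase hk) (Finset.ne_of_mem_erase hk)
      refine ⟨_, hσ, ?_, i, hfi, ?_⟩
      · have hset : ((insert j (τ.erase i) : Finset (Fin N)) : Set (Fin N)) ∩
            {k | f (φ k) = 0} = ((τ.erase i : Finset (Fin N)) : Set (Fin N)) := by
          rw [← hfilter, Finset.coe_filter, hfilter]
          rfl
        rw [FacetOf, hset, Set.ncard_coe_finset, Finset.card_erase_of_mem hi, h.1]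
      · rw [hfilter, Finset.insert_erase hi]
  · rintro (⟨hτ, hcut⟩ | ⟨σ, hσ, hfacet, i, hfi, rfl⟩)
    · exact hI.mem_of_cut hI' hx hx' hgenI hy' hτ hcut
    · obtain ⟨j₀, hj₀, hfj₀⟩ := exists_pos_of_mem_Fcone (interior_subset hy) hfy hσ
      obtain ⟨j, hj, hfj, hz, heq⟩ :=
        (hI.1 σ hσ).exists_filter_eq_erase hfacet ⟨j₀, hj₀, hfj₀.ne'⟩
      rw [heq]
      exact hI.insert_erase_mem hI' hx hx' hgenI hfx hy' hfy' hσ hj hz hfj hfi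

end
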